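/- arXiv:math/0403176 — 3 statements merged into one kernel-verified Lean document; each statement's English description precedes it below -/
import Mathlib

section
/- Let p be a prime, x ∈ ℚ_p, and e an integer with e ≤ 0 and v_p(x) ≥ e (this includes x = 0). For any positive integer t, the number N(t) = #{r ∈ ℚ : H(r) = t and v_p(r − x) ≥ e} satisfies: if v_p(t) = 0 then |N(t) − 2(2 − p^{e−1}) φ(t)| ≤ 4 d(t); if 0 < v_p(t) < 1 − e then N(t) = 4 φ(t); and if v_p(t) ≥ 1 − e then N(t) = 2 φ(t). -/
/-- The height of a rational number: for `r = m/n` in lowest terms,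
`H(r) = max (|m|, n)`; in particular `H(0) = 1`. -/
def ratHeight (r : ℚ) : ℕ := max r.num.natAbs r.den

open ArithmeticFunction in
/-- Möbius inversion of the coprimality condition: counting elements coprime to `t`. -/
lemma card_filter_coprime_eq_sum_moebius (s : Finset ℕ) {t : ℕ} (ht : t ≠ 0) :
    ((s.filter (t.Coprime ·)).card : ℤ) =
      ∑ d ∈ t.divisors, moebius d * ((s.filter (d ∣ ·)).card : ℤ) := by
  have key (n : ℕ) : (if t.Coprime n then 1 else 0 : ℤ) =
      ∑ d ∈ t.divisors, moebius d * (if d ∣ n then 1 else 0) := by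
    have h := congrArg (fun f : ArithmeticFunction ℤ ↦ f (t.gcd n)) coe_zeta_mul_moebius
    simp only [coe_zeta_mul_apply, one_apply] at h
    have hd : (t.gcd n).divisors = t.divisors.filter (· ∣ n) := by
      ext d
      simp [Nat.dvd_gcd_iff, ht]
    rw [hd, Finset.sum_filter] at h
    simpa [Nat.Coprime] using h.symm
  simp only [Finset.card_filter, Nat.cast_sum, Finset.mul_sum]
  rw [Finset.sum_comm]
  exact Finset.sum_congr rfl fun n _ ↦ by simpa using key n

lemma card_range_filter_dvd (t : ℕ) {D : ℕ} (hD : 0 < D) :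
    ((Finset.range t).filter (D ∣ ·)).card = t / D + if 0 < t % D then 1 else 0 := by
  have h := Nat.count_modEq_card t hD 0
  rw [Nat.count_eq_card_filter_range, Nat.zero_mod] at h
  rw [← h]
  exact congrArg _ (Finset.filter_congr fun n _ ↦ Nat.modEq_zero_iff_dvd.symm)

lemma abs_card_range_filter_dvd_sub_le (t : ℕ) {D : ℕ} (hD : 0 < D) :
    |(((Finset.range t).filter (D ∣ ·)).card : ℝ) - (t : ℝ) / D| ≤ 1 := by
  rw [card_range_filter_dvd t hD]
  have hD' : (0 : ℝ) < D := by exact_mod_cast hD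
  have hlt : (t % D : ℕ) < D := Nat.mod_lt _ hD
  have hlt' : ((t % D : ℕ) : ℝ) < D := by exact_mod_cast hlt
  have hdiv : (t : ℝ) / D = (t / D : ℕ) + ((t % D : ℕ) : ℝ) / D := by
    field_simp
    exact_mod_cast (Nat.div_add_mod t D).symm
  have h1 : ((t % D : ℕ) : ℝ) / D < 1 := (div_lt_one hD').2 hlt'
  have h0 : 0 ≤ ((t % D : ℕ) : ℝ) / D := by positivity
  rw [hdiv, abs_le]
  split_ifs with h <;> push_cast <;> constructor <;> linarith

/-- Residues coprime to `t` are equidistributed among multiples of a modulus `q` prime to `t`,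
up to an error `d(t)`. -/
lemma abs_card_coprime_multiples_sub_le {t q : ℕ} (ht : 0 < t) (hq : 0 < q)
    (htq : t.Coprime q) :
    |(((Finset.range t).filter fun n ↦ t.Coprime n ∧ q ∣ n).card : ℝ) - (t.totient : ℝ) / q|
      ≤ t.divisors.card := by
  have hsum : (((Finset.range t).filter fun n ↦ t.Coprime n ∧ q ∣ n).card : ℝ) =
      ∑ d ∈ t.divisors, (ArithmeticFunction.moebius d : ℝ) *
        (((Finset.range t).filter (q * d ∣ ·)).card : ℝ) := by
    have h := card_filter_coprime_eq_sum_moebius ((Finset.range t).filter (q ∣ ·)) ht.ne'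
    rw [Finset.filter_filter, Finset.filter_congr (fun n _ ↦ and_comm)] at h
    have h' := congrArg (fun z : ℤ ↦ (z : ℝ)) h
    push_cast at h'
    rw [h']
    refine Finset.sum_congr rfl fun d hd ↦ ?_
    have hc : q.Coprime d := (htq.coprime_dvd_left (Nat.dvd_of_mem_divisors hd)).symm
    rw [Finset.filter_filter,
      Finset.filter_congr (fun n _ ↦
      (⟨fun h ↦ hc.mul_dvd_of_dvd_of_dvd h.1 h.2,
        fun h ↦ ⟨dvd_of_mul_right_dvd h, dvd_of_mul_left_dvd h⟩⟩ :
          q ∣ n ∧ d ∣ n ↔ q * d ∣ n))]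
  have htot : (t.totient : ℝ) =
      ∑ d ∈ t.divisors, (ArithmeticFunction.moebius d : ℝ) * ((t : ℝ) / d) := by
    have h := card_filter_coprime_eq_sum_moebius (Finset.range t) ht.ne'
    have h' := congrArg (fun z : ℤ ↦ (z : ℝ)) h
    push_cast at h'
    rw [Nat.totient_eq_card_coprime, h']
    refine Finset.sum_congr rfl fun d hd ↦ ?_
    have hdt := Nat.dvd_of_mem_divisors hd
    have hd0 := Nat.pos_of_mem_divisors hd
    rw [card_range_filter_dvd t hd0, Nat.mod_eq_zero_of_dvd hdt]
    simp [Nat.cast_div hdt (by positivity : (d : ℝ) ≠ 0)]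
  rw [hsum, htot, Finset.sum_div, ← Finset.sum_sub_distrib, Finset.card_eq_sum_ones,
    Nat.cast_sum]
  refine (Finset.abs_sum_le_sum_abs _ _).trans (Finset.sum_le_sum fun d hd ↦ ?_)
  have hd0 := Nat.pos_of_mem_divisors hd
  have hmu : |(ArithmeticFunction.moebius d : ℝ)| ≤ 1 := by
    exact_mod_cast ArithmeticFunction.abs_moebius_le_one (n := d)
  have hb := abs_card_range_filter_dvd_sub_le t (Nat.mul_pos hq hd0)
  have heq : (t : ℝ) / d / q = (t : ℝ) / ((q * d : ℕ) : ℝ) := by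
    rw [div_div, mul_comm]
    push_cast
    rfl
  rw [mul_div_assoc, ← mul_sub, abs_mul, heq, Nat.cast_one]
  exact mul_le_one₀ hmu (abs_nonneg _) hb

lemma padic_norm_rat_le_pow_iff (p : ℕ) [hp : Fact p.Prime] (r : ℚ) (k : ℕ) :
    ‖(r : ℚ_[p])‖ ≤ (p : ℝ) ^ (k : ℤ) ↔ ¬ p ^ (k + 1) ∣ r.den := by
  have hp0 : (0 : ℝ) < p := by exact_mod_cast hp.out.pos
  have hp1 : (1 : ℝ) < p := by exact_mod_cast hp.out.one_lt
  have hden : p ^ (k + 1) ∣ r.den ↔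
      ‖((r.den : ℤ) : ℚ_[p])‖ ≤ (p : ℝ) ^ (-((k + 1 : ℕ) : ℤ)) := by
    rw [Padic.norm_int_le_pow_iff_dvd]
    norm_cast
  have hden0 : ((r.den : ℤ) : ℚ_[p]) ≠ 0 := by exact_mod_cast r.den_ne_zero
  have hmul : ‖(r : ℚ_[p])‖ * ‖((r.den : ℤ) : ℚ_[p])‖ = ‖(r.num : ℚ_[p])‖ := by
    rw [← norm_mul]
    congr 1
    have h := congrArg (fun z : ℚ ↦ (z : ℚ_[p])) (Rat.mul_den_eq_num r)
    push_cast at h ⊢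
    exact h
  constructor
  · intro h hdvd
    have hnum : ‖(r.num : ℚ_[p])‖ = 1 := by
      rw [Padic.norm_intCast_eq_one_iff]
      have hpd : p ∣ r.den := (dvd_pow_self p k.succ_ne_zero).trans hdvd
      have := r.reduced.coprime_dvd_right hpd
      rwa [Int.isCoprime_iff_nat_coprime]
    have hle := mul_le_mul h (hden.1 hdvd) (norm_nonneg _) (by positivity)
    rw [hmul, hnum, ← zpow_add₀ hp0.ne'] at hle
    have : (k : ℤ) + -((k + 1 : ℕ) : ℤ) = -1 := by push_cast; ring
    rw [this, zpow_neg_one] at hle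
    exact absurd hle (not_le.2 (inv_lt_one_of_one_lt₀ hp1))
  · intro h
    rw [hden, Padic.norm_le_pow_iff_norm_lt_pow_add_one, not_lt] at h
    have he : -((k + 1 : ℕ) : ℤ) + 1 = -(k : ℤ) := by push_cast; ring
    rw [he, zpow_neg] at h
    have hnum : ‖(r.num : ℚ_[p])‖ ≤ 1 := Padic.norm_int_le_one _
    have h2 := mul_le_mul_of_nonneg_left h (norm_nonneg (r : ℚ_[p]))
    rw [hmul] at h2
    have hpk : (0 : ℝ) < (p : ℝ) ^ (k : ℤ) := by positivity
    have h3 := h2.trans hnum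
    rwa [← div_eq_mul_inv, div_le_one hpk] at h3

/-- Translating by an element of the ball of radius `c` does not change membership in it. -/
lemma padic_norm_sub_le_iff {p : ℕ} [Fact p.Prime] {x : ℚ_[p]} {c : ℝ} (hx : ‖x‖ ≤ c)
    (y : ℚ_[p]) : ‖y - x‖ ≤ c ↔ ‖y‖ ≤ c := by
  constructor
  · intro h
    have := Padic.nonarchimedean (y - x) x
    rw [sub_add_cancel] at this
    exact this.trans (max_le h hx)
  · intro h
    have := Padic.nonarchimedean y (-x)
    rw [norm_neg, ← sub_eq_add_neg] at this
    exact this.trans (max_le h hx)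

lemma card_image_natCast_union_neg {B : Finset ℕ} (hB : 0 ∉ B) :
    (B.image (fun n : ℕ ↦ (n : ℤ)) ∪ B.image (fun n : ℕ ↦ -(n : ℤ))).card = 2 * B.card := by
  rw [Finset.card_union_of_disjoint, Finset.card_image_of_injective _ Nat.cast_injective,
    Finset.card_image_of_injective B (f := fun n : ℕ ↦ -(n : ℤ))
      (neg_injective.comp Nat.cast_injective), two_mul]
  rw [Finset.disjoint_left]
  simp only [Finset.mem_image, not_exists, not_and]
  rintro _ ⟨a, ha, rfl⟩ b hb h
  have : a = 0 := by omega
  exact hB (this ▸ ha)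

lemma mem_image_natCast_union_neg {B : Finset ℕ} {z : ℤ} :
    z ∈ B.image (fun n : ℕ ↦ (n : ℤ)) ∪ B.image (fun n : ℕ ↦ -(n : ℤ)) ↔ z.natAbs ∈ B := by
  simp only [Finset.mem_union, Finset.mem_image]
  constructor
  · rintro (⟨a, ha, rfl⟩ | ⟨a, ha, rfl⟩) <;> simpa using ha
  · intro h
    rcases Int.natAbs_eq z with hz | hz
    · exact Or.inl ⟨_, h, hz.symm⟩
    · exact Or.inr ⟨_, h, hz.symm⟩

/-- Rationals of height `t > 1` with a condition `P` on the denominator, counted by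
numerator and denominator. -/
lemma card_ratHeight_eq (t : ℕ) (ht : 1 < t) (P : ℕ → Prop) [DecidablePred P] :
    Nat.card {r : ℚ // ratHeight r = t ∧ P r.den} =
      2 * ((Finset.range t).filter fun n ↦ t.Coprime n ∧ P n).card +
        if P t then 2 * t.totient else 0 := by
  set B := (Finset.range t).filter (t.Coprime ·) with hBdef
  set A := (Finset.range t).filter fun n ↦ t.Coprime n ∧ P n with hAdef
  let sgn : Finset ℕ → Finset ℤ := fun C ↦
    C.image (fun n : ℕ ↦ (n : ℤ)) ∪ C.image (fun n : ℕ ↦ -(n : ℤ))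
  have hB0 : 0 ∉ B := by
    simp only [hBdef, Finset.mem_filter, Nat.coprime_zero_right]
    omega
  let F : Finset (ℤ × ℕ) := sgn {t} ×ˢ A ∪ sgn B ×ˢ (if P t then {t} else ∅)
  have hF (z : ℤ × ℕ) : z ∈ F ↔
      z.1.natAbs.Coprime z.2 ∧ max z.1.natAbs z.2 = t ∧ P z.2 := by
    obtain ⟨m, n⟩ := z
    simp only [F, sgn, Finset.mem_union, Finset.mem_product]
    rw [← Finset.mem_union, ← Finset.mem_union, mem_image_natCast_union_neg,
      mem_image_natCast_union_neg]
    simp only [hAdef, hBdef, Finset.mem_singleton, Finset.mem_filter, Finset.mem_range]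
    constructor
    · rintro (⟨hm, hn, hc, hP⟩ | ⟨⟨hm, hc⟩, hn⟩)
      · exact ⟨hm ▸ hc, by omega, hP⟩
      · split_ifs at hn with hP
        · rw [Finset.mem_singleton] at hn
          exact ⟨hn ▸ hc.symm, by omega, hn ▸ hP⟩
        · simp at hn
    · rintro ⟨hc, hmax, hP⟩
      have hne : m.natAbs ≠ n := by
        intro h
        rw [h, Nat.coprime_self] at hc
        omega
      rcases lt_or_gt_of_ne hne with h | h
      · have hn : n = t := by omega
        rw [← hn, if_pos hP]
        exact Or.inr ⟨⟨h, hc.symm⟩, by simp⟩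
      · have hm : m.natAbs = t := by omega
        exact Or.inl ⟨hm, by omega, hm ▸ hc, hP⟩
  let f : {r : ℚ // ratHeight r = t ∧ P r.den} → F := fun r ↦
    ⟨(r.1.num, r.1.den), (hF _).2 ⟨r.1.reduced, r.2⟩⟩
  have hf : Function.Bijective f := by
    constructor
    · rintro ⟨r, hr⟩ ⟨s, hs⟩ h
      simp only [f, Subtype.mk.injEq, Prod.mk.injEq] at h
      exact Subtype.ext (Rat.ext h.1 h.2)
    · rintro ⟨⟨m, n⟩, h⟩
      have h' := (hF _).1 h
      have hn : n ≠ 0 := by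
        rintro rfl
        have h1 : m.natAbs = 1 := by simpa using h'.1
        have h2 := h'.2.1
        simp only [h1] at h2
        omega
      exact ⟨⟨⟨m, n, hn, h'.1⟩, h'.2⟩, rfl⟩
  have hdisj : Disjoint (sgn {t} ×ˢ A) (sgn B ×ˢ (if P t then {t} else ∅)) := by
    rw [Finset.disjoint_left]
    rintro ⟨m, n⟩ h1 h2
    rw [Finset.mem_product] at h1 h2
    have hm := mem_image_natCast_union_neg.1 h1.1
    have hm' := mem_image_natCast_union_neg.1 h2.1
    simp only [hBdef, Finset.mem_singleton, Finset.mem_filter, Finset.mem_range] at hm hm'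
    omega
  have hs : (sgn {t}).card = 2 := by
    exact card_image_natCast_union_neg (B := {t}) (by simp; omega)
  have hsB : (sgn B).card = 2 * t.totient := by
    rw [Nat.totient_eq_card_coprime]
    exact card_image_natCast_union_neg hB0
  rw [Nat.card_eq_of_bijective f hf, Nat.card_eq_fintype_card, Fintype.card_coe,
    Finset.card_union_of_disjoint hdisj, Finset.card_product, Finset.card_product, hs, hsB]
  split_ifs <;> simp

/-- The only rationals of height one are `0`, `1` and `-1`. -/
lemma card_ratHeight_one (P : ℕ → Prop) (hP : P 1) :
    Nat.card {r : ℚ // ratHeight r = 1 ∧ P r.den} = 3 := by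
  have hset : {r : ℚ | ratHeight r = 1 ∧ P r.den} = (({0, 1, -1} : Finset ℚ) : Set ℚ) := by
    ext r
    simp only [Set.mem_ofPred_eq, Finset.coe_insert, Finset.coe_singleton,
      Set.mem_insert_iff, Set.mem_singleton_iff]
    constructor
    · rintro ⟨h, -⟩
      unfold ratHeight at h
      have hd : r.den = 1 := by
        have := r.den_pos
        omega
      have hr : r = (r.num : ℚ) := (Rat.coe_int_num_of_den_eq_one hd).symm
      have hn : r.num = 0 ∨ r.num = 1 ∨ r.num = -1 := by omega
      rcases hn with hn | hn | hn <;> rw [hn] at hr <;> simp [hr]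
    · rintro (rfl | rfl | rfl) <;> simpa [ratHeight] using hP
  change Nat.card {r : ℚ | ratHeight r = 1 ∧ P r.den} = 3
  rw [hset, Nat.card_coe_set_eq, Set.ncard_coe_finset]
  norm_num

/-- Proposition 5 of the paper, `e ≤ 0` case: for a prime `p`, `x ∈ ℚ_p` and
an integer `e ≤ 0` with `v_p(x) ≥ e` (true in particular for `x = 0`), the
count `N(t)` of rationals `r` of height exactly `t` with `v_p(r - x) ≥ e`
(equivalently `|r - x|_p ≤ p^{-e}`) satisfies:
`|N(t) - 2 (2 - p^{e-1}) φ(t)| ≤ 4 d(t)` if `v_p(t) = 0`; `N(t) = 4 φ(t)` if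
`0 < v_p(t) < 1 - e`; and `N(t) = 2 φ(t)` if `v_p(t) ≥ 1 - e`. -/
theorem slice_count_nonpos_exponent
    (p : ℕ) [hp : Fact p.Prime] (x : ℚ_[p]) (e : ℤ) (he : e ≤ 0)
    (hx : x = 0 ∨ e ≤ x.valuation) (t : ℕ) (ht : 0 < t) :
    (padicValNat p t = 0 →
      |(Nat.card {r : ℚ // ratHeight r = t ∧ ‖(r : ℚ_[p]) - x‖ ≤ (p : ℝ) ^ (-e)} : ℝ)
        - 2 * (2 - (p : ℝ) ^ (e - 1)) * (t.totient : ℝ)| ≤ 4 * (t.divisors.card : ℝ)) ∧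
    (0 < padicValNat p t → (padicValNat p t : ℤ) < 1 - e →
      Nat.card {r : ℚ // ratHeight r = t ∧ ‖(r : ℚ_[p]) - x‖ ≤ (p : ℝ) ^ (-e)}
        = 4 * t.totient) ∧
    (1 - e ≤ (padicValNat p t : ℤ) →
      Nat.card {r : ℚ // ratHeight r = t ∧ ‖(r : ℚ_[p]) - x‖ ≤ (p : ℝ) ^ (-e)}
        = 2 * t.totient) := by
  obtain ⟨k, rfl⟩ : ∃ k : ℕ, e = -(k : ℤ) := ⟨e.natAbs, by omega⟩
  have hp0 : (0 : ℝ) < p := by exact_mod_cast hp.out.pos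
  have hp1 : (1 : ℝ) < p := by exact_mod_cast hp.out.one_lt
  have hxn : ‖x‖ ≤ (p : ℝ) ^ (k : ℤ) := by
    by_cases h0 : x = 0
    · rw [h0, norm_zero]
      positivity
    · rw [Padic.norm_eq_zpow_neg_valuation h0]
      have hv := hx.resolve_left h0
      exact zpow_le_zpow_right₀ hp1.le (by omega)
  set q := p ^ (k + 1) with hq
  have hq0 : 0 < q := pow_pos hp.out.pos _
  have hiff (r : ℚ) : (ratHeight r = t ∧ ‖(r : ℚ_[p]) - x‖ ≤ (p : ℝ) ^ (-(-(k : ℤ)))) ↔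
      (ratHeight r = t ∧ ¬ q ∣ r.den) := by
    rw [neg_neg, padic_norm_sub_le_iff hxn, padic_norm_rat_le_pow_iff]
  have hdvd : q ∣ t ↔ k + 1 ≤ padicValNat p t := padicValNat_dvd_iff_le ht.ne'
  have hval : padicValNat p t ≠ 0 → 1 < t := by
    intro h
    by_contra h1
    have : t = 1 := by omega
    simp [this] at h
  have hall : p ∣ t →
      ((Finset.range t).filter fun n ↦ t.Coprime n ∧ ¬ q ∣ n).card = t.totient := by
    intro hpt
    rw [Nat.totient_eq_card_coprime]
    congr 1
    refine Finset.filter_congr fun n _ ↦ and_iff_left_of_imp fun hc hqn ↦ ?_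
    have hpn : p ∣ n := (dvd_pow_self p k.succ_ne_zero).trans hqn
    exact Nat.not_coprime_of_dvd_of_dvd hp.out.one_lt hpt hpn hc
  rw [Nat.card_congr (Equiv.subtypeEquivRight hiff)]
  refine ⟨fun h0 ↦ ?_, fun h1 h2 ↦ ?_, fun h1 ↦ ?_⟩
  · have hpt : ¬ p ∣ t := fun h ↦ by
      have := one_le_padicValNat_of_dvd ht.ne' h
      omega
    have hqt : ¬ q ∣ t := fun h ↦ hpt ((dvd_pow_self p k.succ_ne_zero).trans h)
    have hpq : (p : ℝ) ^ (-(k : ℤ) - 1) = 1 / (q : ℝ) := by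
      rw [hq, one_div, show -(k : ℤ) - 1 = -((k + 1 : ℕ) : ℤ) by push_cast; ring, zpow_neg,
        zpow_natCast]
      push_cast
      rfl
    rw [hpq]
    rcases (show t = 1 ∨ 1 < t by omega) with rfl | ht1
    · rw [card_ratHeight_one (fun n ↦ ¬ q ∣ n) hqt]
      have hq1 : (1 : ℝ) ≤ q := by exact_mod_cast hq0
      have hle : 1 / (q : ℝ) ≤ 1 := (div_le_one (by linarith)).2 hq1
      have hge : 0 ≤ 1 / (q : ℝ) := by positivity
      simp only [Nat.totient_one, Nat.divisors_one, Finset.card_singleton]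
      rw [abs_le]
      push_cast
      constructor <;> linarith
    · rw [card_ratHeight_eq t ht1 (fun n ↦ ¬ q ∣ n), if_pos hqt]
      have htq : t.Coprime q :=
        Nat.Coprime.pow_right _ ((Nat.Prime.coprime_iff_not_dvd hp.out).2 hpt).symm
      have hb := abs_card_coprime_multiples_sub_le ht hq0 htq
      have hsplit := Finset.card_filter_add_card_filter_not
        (s := (Finset.range t).filter (t.Coprime ·)) (fun n ↦ q ∣ n)
      rw [Finset.filter_filter, Finset.filter_filter, ← Nat.totient_eq_card_coprime] at hsplit
      have hsplit' := congrArg (fun n : ℕ ↦ (n : ℝ)) hsplit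
      push_cast at hsplit' ⊢
      have hd0 : (0 : ℝ) ≤ t.divisors.card := by positivity
      rw [abs_le] at hb ⊢
      have hdiv : (t.totient : ℝ) / q = 1 / (q : ℝ) * t.totient := by ring
      rw [hdiv] at hb
      constructor <;> linarith [hb.1, hb.2]
  · have hpt : p ∣ t := dvd_of_one_le_padicValNat h1
    have hqt : ¬ q ∣ t := fun h ↦ by
      have := hdvd.1 h
      omega
    rw [card_ratHeight_eq t (hval h1.ne') (fun n ↦ ¬ q ∣ n), if_pos hqt, hall hpt]
    ring
  · have h1' : k + 1 ≤ padicValNat p t := by omega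
    have hpt : p ∣ t := dvd_of_one_le_padicValNat (by omega)
    rw [card_ratHeight_eq t (hval (by omega)) (fun n ↦ ¬ q ∣ n),
      if_neg (not_not.2 (hdvd.2 h1')), hall hpt, add_zero]
end

section
/- Let p be a prime, x ∈ ℚ_p nonzero with v_p(x) > 0, and e an integer with e > v_p(x). For any positive integer t, the number N(t) = #{r ∈ ℚ : H(r) = t and v_p(r − x) ≥ e} satisfies: if v_p(t) = 0 then |N(t) − 2 p^{-e} φ(t)| ≤ 4 d(t); if v_p(t) = v_p(x) then |N(t) − 2 (p^{1 + v_p(x) − e}/(p − 1)) φ(t)| ≤ 4 d(t); and N(t) = 0 otherwise. -/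
open ArithmeticFunction in
theorem sum_divisors_moebius (n : ℕ) :
    ∑ d ∈ n.divisors, moebius d = if n = 1 then 1 else 0 := by
  rw [← coe_mul_zeta_apply, moebius_mul_coe_zeta, one_apply]

open ArithmeticFunction in
theorem ite_coprime_eq_sum_moebius {s : ℕ} (hs : s ≠ 0) (m : ℤ) :
    (if IsCoprime m (s : ℤ) then (1 : ℤ) else 0) =
      ∑ d ∈ s.divisors, if (d : ℤ) ∣ m then moebius d else 0 := by
  rw [← Finset.sum_filter]
  have h : s.divisors.filter (fun d : ℕ => (d : ℤ) ∣ m) = (m.gcd s).divisors := by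
    ext d
    simp only [Finset.mem_filter, Nat.mem_divisors, Int.dvd_gcd_iff, Int.natCast_dvd_natCast]
    have : m.gcd s ≠ 0 := by simp [Int.gcd_eq_zero_iff, hs]
    tauto
  rw [h, sum_divisors_moebius]
  simp only [Int.isCoprime_iff_gcd_eq_one]

open ArithmeticFunction in
theorem totient_div_eq_sum_moebius {s : ℕ} (hs : 0 < s) :
    (s.totient : ℝ) / s = ∑ d ∈ s.divisors, (moebius d : ℝ) / d := by
  have h := (sum_eq_iff_sum_mul_moebius_eq (R := ℝ) (f := fun n => (n.totient : ℝ))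
    (g := fun n => (n : ℝ))).1 (fun n _ => by exact_mod_cast n.sum_totient) s hs
  rw [← h, Nat.sum_divisorsAntidiagonal (f := fun a b => (moebius a : ℝ) * (b : ℝ)),
    Finset.sum_div]
  refine Finset.sum_congr rfl fun d hd => ?_
  have hd' := Nat.dvd_of_mem_divisors hd
  have hd0 : (d : ℝ) ≠ 0 := by exact_mod_cast (Nat.pos_of_mem_divisors hd).ne'
  have hs0 : (s : ℝ) ≠ 0 := by exact_mod_cast hs.ne'
  rw [Nat.cast_div hd' hd0]
  field_simp

theorem abs_card_Ioc_modEq_sub_le {a b : ℤ} (hab : a ≤ b) {r : ℤ} (hr : 0 < r) (v : ℤ) :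
    |((Finset.Ioc a b).filter (fun x => x ≡ v [ZMOD r])).card - ((b - a : ℤ) : ℝ) / r| ≤ 1 := by
  have h := Int.Ioc_filter_modEq_card a b hr v
  have hr' : (0 : ℚ) < r := by exact_mod_cast hr
  have hle : ((a - v : ℤ) / r : ℚ) ≤ (b - v : ℤ) / r := by gcongr
  push_cast at hle
  rw [max_eq_left (sub_nonneg.2 (Int.floor_le_floor hle))] at h
  have key : |((((Finset.Ioc a b).filter (fun x => x ≡ v [ZMOD r])).card : ℤ) : ℚ)
      - ((b - a : ℤ) : ℚ) / r| ≤ 1 := by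
    rw [h]
    have e : ((b - a : ℤ) : ℚ) / r = (b - v) / r - (a - v) / r := by push_cast; ring
    rw [e, abs_le]
    push_cast
    have h1 := Int.floor_le ((b - v : ℚ) / r)
    have h2 := Int.lt_floor_add_one ((b - v : ℚ) / r)
    have h3 := Int.floor_le ((a - v : ℚ) / r)
    have h4 := Int.lt_floor_add_one ((a - v : ℚ) / r)
    constructor <;> linarith
  exact_mod_cast key

theorem exists_dvd_and_modEq_iff {d M : ℕ} (h : d.Coprime M) (c : ℤ) :
    ∃ v : ℤ, ∀ x : ℤ, ((d : ℤ) ∣ x ∧ x ≡ c [ZMOD M]) ↔ x ≡ v [ZMOD ((d * M : ℕ) : ℤ)] := by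
  obtain ⟨u, w, huw⟩ := (Nat.isCoprime_iff_coprime.2 h)
  refine ⟨c * (u * d), fun x => ?_⟩
  push_cast
  rw [← Int.modEq_and_modEq_iff_modEq_mul (by simpa using h)]
  refine and_congr ?_ ?_
  · rw [Int.modEq_comm, Int.modEq_iff_dvd, dvd_sub_left (Dvd.intro_left (c * u) (by ring))]
  · have : c * (u * d) ≡ c [ZMOD M] := by
      rw [Int.modEq_iff_dvd]
      exact ⟨c * w, by linear_combination (-c) * huw⟩
    exact ⟨fun h => h.trans this.symm, fun h => h.trans this⟩

open ArithmeticFunction in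
/-- The number of integers of an interval that lie in a fixed residue class modulo `M` and are
coprime to `s`, for `s` and `M` coprime. -/
theorem abs_card_Ioc_modEq_coprime_sub_le {a b : ℤ} (hab : a ≤ b) {s M : ℕ} (hs : 0 < s)
    (hM : 0 < M) (hsM : s.Coprime M) (c : ℤ) :
    |((Finset.Ioc a b).filter (fun x => x ≡ c [ZMOD M] ∧ IsCoprime x (s : ℤ))).card
      - ((b - a : ℤ) : ℝ) / M * (s.totient / s)| ≤ s.divisors.card := by
  have hcard : (((Finset.Ioc a b).filter
      (fun x => x ≡ c [ZMOD M] ∧ IsCoprime x (s : ℤ))).card : ℤ) =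
      ∑ d ∈ s.divisors, moebius d *
        ((Finset.Ioc a b).filter (fun x => (d : ℤ) ∣ x ∧ x ≡ c [ZMOD M])).card := by
    rw [← Finset.filter_filter, Finset.card_filter]
    push_cast
    simp_rw [ite_coprime_eq_sum_moebius hs.ne']
    rw [Finset.sum_comm]
    refine Finset.sum_congr rfl fun d _ => ?_
    rw [← Finset.sum_filter, Finset.filter_filter, Finset.sum_const, nsmul_eq_mul, mul_comm]
    simp only [and_comm]
  have hcard' : (((Finset.Ioc a b).filter
      (fun x => x ≡ c [ZMOD M] ∧ IsCoprime x (s : ℤ))).card : ℝ) =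
      ∑ d ∈ s.divisors, (moebius d : ℝ) *
        ((Finset.Ioc a b).filter (fun x => (d : ℤ) ∣ x ∧ x ≡ c [ZMOD M])).card := by
    exact_mod_cast congrArg (Int.cast : ℤ → ℝ) hcard
  rw [hcard', totient_div_eq_sum_moebius hs, Finset.mul_sum, ← Finset.sum_sub_distrib]
  refine (Finset.abs_sum_le_sum_abs _ _).trans ?_
  rw [Finset.card_eq_sum_ones]
  push_cast
  refine Finset.sum_le_sum fun d hd => ?_
  have hd0 := Nat.pos_of_mem_divisors hd
  obtain ⟨v, hv⟩ := exists_dvd_and_modEq_iff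
    (hsM.coprime_dvd_left (Nat.dvd_of_mem_divisors hd)) c
  simp_rw [hv]
  have h := abs_card_Ioc_modEq_sub_le hab (r := ((d * M : ℕ) : ℤ)) (by positivity) v
  have hμ : |(moebius d : ℝ)| ≤ 1 := by exact_mod_cast abs_moebius_le_one (n := d)
  have e : ∀ C : ℝ, (moebius d : ℝ) * C - ((b : ℝ) - a) / M * (moebius d / d) =
      moebius d * (C - ((b - a : ℤ) : ℝ) / ((d * M : ℕ) : ℤ)) := by
    intro C
    push_cast
    field_simp
  rw [e, abs_mul]
  exact mul_le_one₀ hμ (abs_nonneg _) h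

theorem ratHeight_intCast_div {a b : ℤ} (hb : b ≠ 0) (h : IsCoprime a b) :
    ratHeight ((a : ℚ) / b) = max a.natAbs b.natAbs := by
  wlog hpos : 0 < b generalizing a b
  · have := this (neg_ne_zero.2 hb) h.neg_neg (by omega)
    simpa [neg_div_neg_eq] using this
  have h' := Int.isCoprime_iff_gcd_eq_one.1 h
  have hden := Rat.den_div_eq_of_coprime hpos h'
  rw [ratHeight, Rat.num_div_eq_of_coprime hpos h', ← hden, Int.natAbs_natCast, hden]

section Padic

variable {p : ℕ} [hp : Fact p.Prime]

theorem exists_norm_sub_intCast_le_iff {y : ℚ_[p]} (hy : ‖y‖ ≤ 1) (k : ℕ) :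
    ∃ c : ℤ, ∀ m : ℤ,
      ‖(m : ℚ_[p]) - y‖ ≤ (p : ℝ) ^ (-k : ℤ) ↔ m ≡ c [ZMOD ((p ^ k : ℕ) : ℤ)] := by
  let z : ℤ_[p] := ⟨y, hy⟩
  have hz := (z - z.appr k).norm_le_pow_iff_mem_span_pow k |>.2 (z.appr_spec k)
  have hy' : ‖y - ((z.appr k : ℤ) : ℚ_[p])‖ ≤ (p : ℝ) ^ (-k : ℤ) := by
    rw [PadicInt.norm_def] at hz
    exact_mod_cast hz
  refine ⟨z.appr k, fun m => ?_⟩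
  rw [Int.modEq_comm, Int.modEq_iff_dvd, Nat.cast_pow, ← Padic.norm_int_le_pow_iff_dvd,
    Int.cast_sub]
  constructor <;> intro h
  · have := Padic.nonarchimedean ((m : ℚ_[p]) - y) (y - ((z.appr k : ℤ) : ℚ_[p]))
    rw [sub_add_sub_cancel] at this
    exact this.trans (max_le h hy')
  · rw [norm_sub_rev] at hy'
    have := Padic.nonarchimedean ((m : ℚ_[p]) - ((z.appr k : ℤ) : ℚ_[p]))
      (((z.appr k : ℤ) : ℚ_[p]) - y)
    rw [sub_add_sub_cancel] at this
    exact this.trans (max_le h hy')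

theorem norm_natCast_eq_zpow_neg_padicValNat {n : ℕ} (hn : n ≠ 0) :
    ‖(n : ℚ_[p])‖ = (p : ℝ) ^ (-(padicValNat p n : ℤ)) := by
  rw [Padic.norm_eq_zpow_neg_valuation (by exact_mod_cast hn), Padic.valuation_natCast]

theorem not_dvd_den_and_norm_num_of_norm_le_one {r : ℚ} (hr : ‖(r : ℚ_[p])‖ ≤ 1) :
    ¬ p ∣ r.den ∧ ‖(r.num : ℚ_[p])‖ = ‖(r : ℚ_[p])‖ := by
  have hmul : (r : ℚ_[p]) * (r.den : ℚ_[p]) = (r.num : ℚ_[p]) := by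
    exact_mod_cast congrArg (Rat.cast : ℚ → ℚ_[p]) r.mul_den_eq_num
  have hnorm : ‖(r : ℚ_[p])‖ * ‖(r.den : ℚ_[p])‖ = ‖(r.num : ℚ_[p])‖ := by
    rw [← norm_mul, hmul]
  have hden : ¬ p ∣ r.den := by
    intro h
    have h1 : ‖(r.den : ℚ_[p])‖ < 1 := Padic.norm_natCast_lt_one_iff.2 h
    have h2 : ‖(r.num : ℚ_[p])‖ < 1 := by
      rw [← hnorm]
      exact (mul_le_of_le_one_left (norm_nonneg _) hr).trans_lt h1
    have h3 : p ∣ r.num.natAbs := Int.natCast_dvd.1 (Padic.norm_intCast_lt_one_iff.1 h2)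
    exact hp.out.one_lt.ne' (Nat.dvd_one.1 (r.reduced ▸ Nat.dvd_gcd h3 h))
  refine ⟨hden, ?_⟩
  rw [← hnorm, Padic.norm_natCast_eq_one_iff.2 ((Nat.Prime.coprime_iff_not_dvd hp.out).2 hden),
    mul_one]

/-- A rational close to an integral `x` has a denominator prime to `p` and a numerator of the
same norm as `x`. -/
theorem not_dvd_den_and_norm_num_of_norm_sub_lt {x : ℚ_[p]} {r : ℚ} (hx : ‖x‖ ≤ 1)
    (hr : ‖(r : ℚ_[p]) - x‖ < ‖x‖) : ¬ p ∣ r.den ∧ ‖(r.num : ℚ_[p])‖ = ‖x‖ := by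
  have h : ‖(r : ℚ_[p])‖ = ‖x‖ := by
    have := Padic.add_eq_max_of_ne hr.ne
    rwa [sub_add_cancel, max_eq_right hr.le] at this
  rw [← h]
  exact not_dvd_den_and_norm_num_of_norm_le_one (h ▸ hx)

theorem card_slice_of_not_dvd {x : ℚ_[p]} {ε : ℝ} (hx : ‖x‖ < 1) (hε : ε < ‖x‖)
    {t : ℕ} (ht : 0 < t) (hpt : ¬ p ∣ t) {M : ℤ} {c : ℤ}
    (hc : ∀ m : ℤ, ‖(m : ℚ_[p]) - t * x‖ ≤ ε ↔ m ≡ c [ZMOD M]) :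
    Nat.card {r : ℚ // ratHeight r = t ∧ ‖(r : ℚ_[p]) - x‖ ≤ ε} =
      ((Finset.Ioc (-t : ℤ) t).filter (fun m => m ≡ c [ZMOD M] ∧ IsCoprime m (t : ℤ))).card := by
  have ht0 : (t : ℚ) ≠ 0 := by exact_mod_cast ht.ne'
  have htp0 : (t : ℚ_[p]) ≠ 0 := by exact_mod_cast ht.ne'
  have htn : ‖(t : ℚ_[p])‖ = 1 :=
    Padic.norm_natCast_eq_one_iff.2 ((Nat.Prime.coprime_iff_not_dvd hp.out).2 hpt)
  have hinj : Function.Injective (fun m : ℤ => (m : ℚ) / t) := fun a b h => by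
    simpa [div_left_inj' ht0] using h
  have hnorm : ∀ m : ℤ, ‖(((m : ℚ) / t : ℚ) : ℚ_[p]) - x‖ = ‖(m : ℚ_[p]) - t * x‖ := by
    intro m
    have : (m : ℚ_[p]) - t * x = t * ((((m : ℚ) / t : ℚ) : ℚ_[p]) - x) := by
      push_cast
      field_simp
    rw [this, norm_mul, htn, one_mul]
  rw [← Set.ncard_coe_finset, ← Set.ncard_image_of_injective _ hinj]
  change Set.ncard {r : ℚ | ratHeight r = t ∧ ‖(r : ℚ_[p]) - x‖ ≤ ε} = _
  congr 1
  ext r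
  simp only [Set.mem_ofPred_eq, Set.mem_image, Finset.coe_filter, Finset.mem_Ioc]
  constructor
  · rintro ⟨hr, hrx⟩
    obtain ⟨hden, hnum⟩ := not_dvd_den_and_norm_num_of_norm_sub_lt hx.le (hrx.trans_lt hε)
    have hpnum : p ∣ r.num.natAbs :=
      Int.natCast_dvd.1 (Padic.norm_intCast_lt_one_iff.1 (hnum ▸ hx))
    have hne : r.num.natAbs ≠ t := fun h => hpt (h ▸ hpnum)
    unfold ratHeight at hr
    have hdt : r.den = t := by omega
    have hrt : (r.num : ℚ) / t = r := by rw [← hdt, Rat.num_div_den]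
    refine ⟨r.num, ⟨by omega, ?_, ?_⟩, hrt⟩
    · rw [← hc, ← hnorm, hrt]
      exact hrx
    · rw [← hdt, Int.isCoprime_iff_gcd_eq_one]
      exact r.reduced
  · rintro ⟨m, ⟨hm, hmc, hcop⟩, rfl⟩
    refine ⟨?_, by rw [hnorm]; exact (hc m).2 hmc⟩
    have := ratHeight_intCast_div (by omega) hcop
    push_cast at this
    rw [this]
    omega

theorem card_slice_of_dvd {x : ℚ_[p]} {ε : ℝ} (hx : ‖x‖ < 1) (hε : ε < ‖x‖)
    {t s : ℕ} (ht : 0 < t) (hpt : p ∣ t)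
    (hts : ∀ n : ℤ, IsCoprime n (t : ℤ) ↔ ‖(n : ℚ_[p])‖ = 1 ∧ IsCoprime n (s : ℤ))
    {M : ℤ} {c : ℤ}
    (hc : ∀ n : ℤ, ‖(t : ℚ_[p]) - n * x‖ ≤ ε ↔ n ≡ c [ZMOD M])
    (hunit : ∀ n : ℤ, n ≡ c [ZMOD M] → ‖(n : ℚ_[p])‖ = 1) :
    Nat.card {r : ℚ // ratHeight r = t ∧ ‖(r : ℚ_[p]) - x‖ ≤ ε} =
      ((Finset.Ioc (-t : ℤ) t).filter (fun n => n ≡ c [ZMOD M] ∧ IsCoprime n (s : ℤ))).card := by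
  have ht0 : (t : ℚ) ≠ 0 := by exact_mod_cast ht.ne'
  have hinj : Function.Injective (fun n : ℤ => (t : ℚ) / n) := fun a b h => by
    have h' : (a : ℚ)⁻¹ = (b : ℚ)⁻¹ := mul_left_cancel₀ ht0 (by simpa [div_eq_mul_inv] using h)
    exact_mod_cast inv_injective h'
  have hnorm : ∀ n : ℤ, ‖(n : ℚ_[p])‖ = 1 →
      ‖(((t : ℚ) / n : ℚ) : ℚ_[p]) - x‖ = ‖(t : ℚ_[p]) - n * x‖ := by
    intro n hn
    have hn0 : (n : ℚ_[p]) ≠ 0 := norm_ne_zero_iff.1 (by rw [hn]; exact one_ne_zero)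
    have : (t : ℚ_[p]) - n * x = n * ((((t : ℚ) / n : ℚ) : ℚ_[p]) - x) := by
      push_cast
      field_simp
    rw [this, norm_mul, hn, one_mul]
  rw [← Set.ncard_coe_finset, ← Set.ncard_image_of_injective _ hinj]
  change Set.ncard {r : ℚ | ratHeight r = t ∧ ‖(r : ℚ_[p]) - x‖ ≤ ε} = _
  congr 1
  ext r
  simp only [Set.mem_ofPred_eq, Set.mem_image, Finset.coe_filter, Finset.mem_Ioc]
  constructor
  · rintro ⟨hr, hrx⟩
    obtain ⟨hden, -⟩ := not_dvd_den_and_norm_num_of_norm_sub_lt hx.le (hrx.trans_lt hε)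
    have hne : r.den ≠ t := fun h => hden (h ▸ hpt)
    have hdpos := r.den_pos
    unfold ratHeight at hr
    have hnt : r.num.natAbs = t := by omega
    obtain ⟨n, hnd, hrn⟩ : ∃ n : ℤ, n.natAbs = r.den ∧ (t : ℚ) / n = r := by
      rcases Int.natAbs_eq r.num with h | h
      · refine ⟨r.den, rfl, ?_⟩
        nth_rewrite 2 [← Rat.num_div_den r]
        rw [h, hnt]
        push_cast
        rfl
      · refine ⟨-r.den, by simp, ?_⟩
        nth_rewrite 2 [← Rat.num_div_den r]
        rw [h, hnt]
        push_cast
        rw [div_neg, neg_div]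
    have hcop : IsCoprime n (t : ℤ) := by
      rw [Int.isCoprime_iff_gcd_eq_one, Int.gcd, hnd, Int.natAbs_natCast, ← hnt, Nat.gcd_comm]
      exact r.reduced
    obtain ⟨hn1, hns⟩ := (hts n).1 hcop
    refine ⟨n, ⟨by omega, ?_, hns⟩, hrn⟩
    rw [← hc, ← hnorm n hn1, hrn]
    exact hrx
  · rintro ⟨n, ⟨hn, hnc, hcop⟩, rfl⟩
    have hn1 := hunit n hnc
    have hn0 : n ≠ 0 := by
      rintro rfl
      simp at hn1
    refine ⟨?_, by rw [hnorm n hn1]; exact (hc n).2 hnc⟩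
    have := ratHeight_intCast_div hn0 ((hts n).2 ⟨hn1, hcop⟩).symm
    push_cast at this
    rw [this]
    omega

end Padic

/-- Proposition 6(1) of the paper: for a prime `p`, a nonzero `x ∈ ℚ_p` with
`v_p(x) > 0` and an integer `e > v_p(x)`, the count `N(t)` of rationals `r` of
height exactly `t` with `v_p(r - x) ≥ e` (equivalently `|r - x|_p ≤ p^{-e}`)
satisfies: `|N(t) - 2 p^{-e} φ(t)| ≤ 4 d(t)` if `v_p(t) = 0`;
`|N(t) - 2 (p^{1 + v_p(x) - e}/(p-1)) φ(t)| ≤ 4 d(t)` if `v_p(t) = v_p(x)`;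
and `N(t) = 0` otherwise. -/
theorem slice_count_val_pos
    (p : ℕ) [hp : Fact p.Prime] (x : ℚ_[p]) (hx : x ≠ 0)
    (hvx : 0 < x.valuation) (e : ℤ) (he : x.valuation < e)
    (t : ℕ) (ht : 0 < t) :
    (padicValNat p t = 0 →
      |(Nat.card {r : ℚ // ratHeight r = t ∧ ‖(r : ℚ_[p]) - x‖ ≤ (p : ℝ) ^ (-e)} : ℝ)
        - 2 * (p : ℝ) ^ (-e) * (t.totient : ℝ)| ≤ 4 * (t.divisors.card : ℝ)) ∧
    ((padicValNat p t : ℤ) = x.valuation →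
      |(Nat.card {r : ℚ // ratHeight r = t ∧ ‖(r : ℚ_[p]) - x‖ ≤ (p : ℝ) ^ (-e)} : ℝ)
        - 2 * ((p : ℝ) ^ (1 + x.valuation - e) / ((p : ℝ) - 1)) * (t.totient : ℝ)|
        ≤ 4 * (t.divisors.card : ℝ)) ∧
    (padicValNat p t ≠ 0 → (padicValNat p t : ℤ) ≠ x.valuation →
      Nat.card {r : ℚ // ratHeight r = t ∧ ‖(r : ℚ_[p]) - x‖ ≤ (p : ℝ) ^ (-e)} = 0) := by
  have hp1 : (1 : ℝ) < p := by exact_mod_cast hp.out.one_lt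
  have hp0 : (p : ℝ) ≠ 0 := by positivity
  have hnx := Padic.norm_eq_zpow_neg_valuation hx
  have hε : (p : ℝ) ^ (-e) < ‖x‖ := by
    rw [hnx]
    exact zpow_lt_zpow_right₀ hp1 (by omega)
  have hx1 : ‖x‖ < 1 := by
    rw [hnx]
    exact zpow_lt_one_of_neg₀ hp1 (by omega)
  obtain ⟨w, hw⟩ := Int.eq_ofNat_of_zero_le hvx.le
  obtain ⟨k, hk⟩ := Int.eq_ofNat_of_zero_le (sub_nonneg.2 he.le)
  have hek : e = ((w + k : ℕ) : ℤ) := by push_cast; omega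
  have hw0 : w ≠ 0 := by omega
  have hk0 : k ≠ 0 := by omega
  have htR : (t : ℝ) ≠ 0 := by exact_mod_cast ht.ne'
  have hdvd : p ∣ t ↔ padicValNat p t ≠ 0 := dvd_iff_padicValNat_ne_zero ht.ne'
  refine ⟨fun hv => ?_, fun hv => ?_, fun hv hv' => ?_⟩
  · have hpt : ¬ p ∣ t := fun h => hdvd.1 h hv
    have htx : ‖(t : ℚ_[p]) * x‖ ≤ 1 := by
      rw [norm_mul]
      exact mul_le_one₀ (by exact_mod_cast Padic.norm_int_le_one t) (norm_nonneg _) hx1.le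
    obtain ⟨c, hc⟩ := exists_norm_sub_intCast_le_iff htx (w + k)
    rw [← hek] at hc
    rw [card_slice_of_not_dvd hx1 hε ht hpt hc]
    have h := abs_card_Ioc_modEq_coprime_sub_le (a := -t) (b := t) (by omega) ht
      (pow_pos hp.out.pos (w + k))
      (((Nat.Prime.coprime_iff_not_dvd hp.out).2 hpt).symm.pow_right (w + k)) c
    have hmain : 2 * (p : ℝ) ^ (-e) * (t.totient : ℝ) =
        ((t - -t : ℤ) : ℝ) / (p ^ (w + k) : ℕ) * (t.totient / t) := by
      rw [hek, zpow_neg, zpow_natCast]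
      push_cast
      field_simp
      ring
    rw [hmain]
    exact h.trans (le_mul_of_one_le_left (Nat.cast_nonneg _) (by norm_num))
  · have hvw : padicValNat p t = w := by omega
    have hpt : p ∣ t := hdvd.2 (by omega)
    obtain ⟨s, hts⟩ : p ^ w ∣ t := hvw ▸ pow_padicValNat_dvd
    have hs : 0 < s := Nat.pos_of_ne_zero (by rintro rfl; simp at hts; omega)
    have hps : ¬ p ∣ s := by
      rintro ⟨u, rfl⟩
      have : p ^ (padicValNat p t + 1) ∣ t := ⟨u, by rw [hvw, hts]; ring⟩
      exact pow_succ_padicValNat_not_dvd ht.ne' this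
    have hcop : p.Coprime s := (Nat.Prime.coprime_iff_not_dvd hp.out).2 hps
    have hntx : ‖(t : ℚ_[p]) / x‖ = 1 := by
      rw [norm_div, norm_natCast_eq_zpow_neg_padicValNat ht.ne', hv, ← hnx,
        div_self (norm_ne_zero_iff.2 hx)]
    obtain ⟨c, hc⟩ := exists_norm_sub_intCast_le_iff hntx.le k
    have hcx : ∀ n : ℤ, ‖(t : ℚ_[p]) - n * x‖ ≤ (p : ℝ) ^ (-e) ↔
        n ≡ c [ZMOD ((p ^ k : ℕ) : ℤ)] := by
      intro n
      have h1 : (t : ℚ_[p]) - n * x = (t / x - n) * x := by field_simp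
      have h2 : (p : ℝ) ^ (-e) = (p : ℝ) ^ (-k : ℤ) * ‖x‖ := by
        rw [hnx, ← zpow_add₀ hp0]
        congr 1
        omega
      rw [← hc, h1, h2, norm_mul, norm_sub_rev,
        mul_le_mul_iff_left₀ (norm_pos_iff.2 hx)]
    have hunit : ∀ n : ℤ, n ≡ c [ZMOD ((p ^ k : ℕ) : ℤ)] → ‖(n : ℚ_[p])‖ = 1 := by
      intro n hn
      have h1 : ‖(n : ℚ_[p]) - t / x‖ < ‖(t : ℚ_[p]) / x‖ := by
        rw [hntx]
        exact ((hc n).2 hn).trans_lt (zpow_lt_one_of_neg₀ hp1 (by omega))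
      have := Padic.add_eq_max_of_ne h1.ne
      rwa [sub_add_cancel, max_eq_right h1.le, hntx] at this
    have hcopt : ∀ n : ℤ, IsCoprime n (t : ℤ) ↔ ‖(n : ℚ_[p])‖ = 1 ∧ IsCoprime n (s : ℤ) := by
      intro n
      rw [hts, Padic.norm_intCast_eq_one_iff]
      push_cast
      rw [IsCoprime.mul_right_iff, IsCoprime.pow_right_iff (Nat.pos_of_ne_zero hw0)]
    rw [card_slice_of_dvd hx1 hε ht hpt hcopt hcx hunit]
    have h := abs_card_Ioc_modEq_coprime_sub_le (a := -t) (b := t) (by omega) hs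
      (pow_pos hp.out.pos k) (hcop.symm.pow_right k) c
    have hsR : (s : ℝ) ≠ 0 := by exact_mod_cast hs.ne'
    have hmain : 2 * ((p : ℝ) ^ (1 + x.valuation - e) / ((p : ℝ) - 1)) * (t.totient : ℝ) =
        ((t - -t : ℤ) : ℝ) / (p ^ k : ℕ) * (s.totient / s) := by
      obtain ⟨v, rfl⟩ := Nat.exists_eq_succ_of_ne_zero hw0
      have hφ : (t.totient : ℝ) = p ^ v * (p - 1) * s.totient := by
        rw [hts, Nat.totient_mul (hcop.pow_left _), Nat.totient_prime_pow_succ hp.out]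
        push_cast [Nat.cast_sub hp.out.one_le]
        ring
      have hexp : (p : ℝ) ^ (1 + x.valuation - e) = p / p ^ k := by
        rw [show 1 + x.valuation - e = 1 - (k : ℤ) by omega, zpow_sub₀ hp0, zpow_one,
          zpow_natCast]
      have hp1' : (p : ℝ) - 1 ≠ 0 := by linarith
      rw [hφ, hexp]
      push_cast
      rw [show (t : ℝ) = p ^ (v + 1) * s by exact_mod_cast hts]
      field_simp
      ring
    rw [hmain]
    have hd : (s.divisors.card : ℝ) ≤ t.divisors.card := by
      exact_mod_cast Finset.card_le_card
        (Nat.divisors_subset_of_dvd ht.ne' (Dvd.intro_left _ hts.symm))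
    exact (h.trans hd).trans (le_mul_of_one_le_left (Nat.cast_nonneg _) (by norm_num))
  · rw [Nat.card_eq_zero]
    refine Or.inl ⟨fun ⟨r, hr, hrx⟩ => ?_⟩
    obtain ⟨hden, hnum⟩ := not_dvd_den_and_norm_num_of_norm_sub_lt hx1.le (hrx.trans_lt hε)
    have hdt : r.den ≠ t := fun h => hden (h ▸ hdvd.2 hv)
    unfold ratHeight at hr
    have hnt : r.num.natAbs = t := by omega
    rw [← norm_natAbs, hnt, norm_natCast_eq_zpow_neg_padicValNat ht.ne', hnx] at hnum
    have := zpow_right_injective₀ (by positivity) hp1.ne' hnum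
    omega
end

section
/- Let p be a prime, x ∈ ℚ_p nonzero with v_p(x) < 0, and e an integer with e > v_p(x). For any positive integer t, the number N(t) = #{r ∈ ℚ : H(r) = t and v_p(r − x) ≥ e} satisfies: if v_p(t) = 0 then |N(t) − 2 p^{2 v_p(x) − e} φ(t)| ≤ 4 d(t); if v_p(t) = −v_p(x) then |N(t) − 2 (p^{1 + v_p(x) − e}/(p − 1)) φ(t)| ≤ 4 d(t); and N(t) = 0 otherwise. (If instead v_p(x) = 0 and e > 0, then |N(t) − 4 p^{-e} φ(t)| ≤ 8 d(t) when v_p(t) = 0, and N(t) = 0 when v_p(t) ≠ 0.) -/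
open Finset ArithmeticFunction in
lemma sum_divisors_moebius_eq_ite {n : ℕ} :
    ∑ d ∈ n.divisors, moebius d = if n = 1 then 1 else 0 := by
  rw [← coe_zeta_mul_apply, coe_zeta_mul_moebius, one_apply]

open Finset ArithmeticFunction in
lemma sum_divisors_moebius_div {n : ℕ} (hn : 0 < n) :
    ∑ d ∈ n.divisors, (moebius d : ℝ) / d = (n.totient : ℝ) / n := by
  have h := (sum_eq_iff_sum_mul_moebius_eq (R := ℝ) (f := fun n ↦ (n.totient : ℝ))
    (g := fun n ↦ (n : ℝ))).1 (fun m _ ↦ by exact_mod_cast Nat.sum_totient m) n hn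
  have hn' : (n : ℝ) ≠ 0 := by positivity
  rw [← h, Nat.sum_divisorsAntidiagonal (f := fun a b ↦ ((moebius a : ℤ) : ℝ) * (b : ℝ)),
    sum_div]
  refine sum_congr rfl fun d hd ↦ ?_
  have hd0 : (d : ℝ) ≠ 0 := by exact_mod_cast (Nat.pos_of_mem_divisors hd).ne'
  rw [Nat.cast_div (Nat.dvd_of_mem_divisors hd) hd0]
  field_simp

open Finset in
lemma abs_card_filter_modEq_sub_le (t : ℕ) {r : ℕ} (hr : 0 < r) (c : ℕ) :
    |(#{n ∈ Ioc 0 t | n ≡ c [MOD r]} : ℝ) - t / r| ≤ 1 := by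
  have h := Nat.Ioc_filter_modEq_card 0 t hr c
  have hr' : (0 : ℚ) < r := by exact_mod_cast hr
  set A : ℚ := ((t : ℚ) - c) / r
  set B : ℚ := (((0 : ℕ) : ℚ) - c) / r
  have hAB : A - B = t / r := by simp only [A, B]; field_simp; push_cast; ring
  have hle : B ≤ A := by
    have : (0 : ℚ) ≤ t / r := by positivity
    linarith
  rw [max_eq_left (sub_nonneg.2 (Int.floor_le_floor hle))] at h
  have key : |(#{n ∈ Ioc 0 t | n ≡ c [MOD r]} : ℚ) - t / r| ≤ 1 := by
    have h' : (#{n ∈ Ioc 0 t | n ≡ c [MOD r]} : ℚ) = (⌊A⌋ : ℚ) - ⌊B⌋ := by exact_mod_cast h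
    rw [h', ← hAB, abs_le]
    constructor <;> linarith [Int.floor_le A, Int.floor_le B, Int.lt_floor_add_one A,
      Int.lt_floor_add_one B]
  have key' := (Rat.cast_le (K := ℝ)).2 key
  push_cast at key'
  exact key'

open Finset ArithmeticFunction in
lemma card_filter_coprime_modEq_eq_sum {s : ℕ} (hs : 0 < s) (t q a : ℕ) :
    (#{n ∈ Ioc 0 t | n.Coprime s ∧ n ≡ a [MOD q]} : ℤ) =
      ∑ d ∈ s.divisors, moebius d * #{n ∈ Ioc 0 t | d ∣ n ∧ n ≡ a [MOD q]} := by
  have h1 : ∀ n : ℕ, (if n.Coprime s then (1 : ℤ) else 0) =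
      ∑ d ∈ s.divisors, if d ∣ n then moebius d else 0 := by
    intro n
    rw [← sum_filter, if_congr (Iff.rfl : n.Coprime s ↔ n.gcd s = 1) rfl rfl,
      ← sum_divisors_moebius_eq_ite]
    refine sum_congr ?_ fun _ _ ↦ rfl
    ext d
    simp [Nat.dvd_gcd_iff, hs.ne', and_comm]
  calc (#{n ∈ Ioc 0 t | n.Coprime s ∧ n ≡ a [MOD q]} : ℤ)
      = ∑ n ∈ Ioc 0 t with n ≡ a [MOD q], if n.Coprime s then (1 : ℤ) else 0 := by
        rw [card_filter, sum_filter]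
        push_cast
        refine sum_congr rfl fun n _ ↦ ?_
        by_cases h : n ≡ a [MOD q] <;> simp [h]
    _ = ∑ d ∈ s.divisors, ∑ n ∈ Ioc 0 t with n ≡ a [MOD q], if d ∣ n then moebius d else 0 := by
        rw [sum_comm]
        exact sum_congr rfl fun n _ ↦ h1 n
    _ = _ := by
        refine sum_congr rfl fun d _ ↦ ?_
        rw [← sum_filter, filter_filter, sum_const, nsmul_eq_mul, mul_comm]
        simp only [and_comm]

open Finset ArithmeticFunction in
/-- Integers up to `t` that are coprime to `s` and lie in a fixed residue class modulo a number
coprime to `s` have the expected count up to the number of divisors of `s`. -/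
lemma abs_card_filter_coprime_modEq_sub_le {s q : ℕ} (hs : 0 < s) (hq : 0 < q)
    (hsq : s.Coprime q) (t a : ℕ) :
    |(#{n ∈ Ioc 0 t | n.Coprime s ∧ n ≡ a [MOD q]} : ℝ) - t / q * (s.totient / s)|
      ≤ #s.divisors := by
  have h := card_filter_coprime_modEq_eq_sum hs t q a
  have h' : (#{n ∈ Ioc 0 t | n.Coprime s ∧ n ≡ a [MOD q]} : ℝ) =
      ∑ d ∈ s.divisors, (moebius d : ℝ) * #{n ∈ Ioc 0 t | d ∣ n ∧ n ≡ a [MOD q]} := by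
    exact_mod_cast h
  rw [h', ← sum_divisors_moebius_div hs, mul_sum, ← sum_sub_distrib, card_eq_sum_ones,
    Nat.cast_sum, Nat.cast_one]
  refine (abs_sum_le_sum_abs _ _).trans (sum_le_sum fun d hd ↦ ?_)
  have hd0 : 0 < d := Nat.pos_of_mem_divisors hd
  have hdq : d.Coprime q := hsq.coprime_dvd_left (Nat.dvd_of_mem_divisors hd)
  have hset : {n ∈ Ioc 0 t | d ∣ n ∧ n ≡ a [MOD q]} =
      {n ∈ Ioc 0 t | n ≡ (Nat.chineseRemainder hdq 0 a : ℕ) [MOD d * q]} := by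
    refine filter_congr fun n _ ↦ ?_
    obtain ⟨c0, ca⟩ := (Nat.chineseRemainder hdq 0 a).2
    rw [← Nat.modEq_and_modEq_iff_modEq_mul hdq, ← Nat.modEq_zero_iff_dvd]
    exact ⟨fun h ↦ ⟨h.1.trans c0.symm, h.2.trans ca.symm⟩, fun h ↦ ⟨h.1.trans c0, h.2.trans ca⟩⟩
  have hcount := abs_card_filter_modEq_sub_le t (Nat.mul_pos hd0 hq)
    (Nat.chineseRemainder hdq 0 a : ℕ)
  rw [← hset] at hcount
  have hd0' : (d : ℝ) ≠ 0 := by positivity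
  have hq0' : (q : ℝ) ≠ 0 := by positivity
  have hmu : |(moebius d : ℝ)| ≤ 1 := by exact_mod_cast abs_moebius_le_one
  calc _ = |(moebius d : ℝ)| *
        |(#{n ∈ Ioc 0 t | d ∣ n ∧ n ≡ a [MOD q]} : ℝ) - t / (d * q : ℕ)| := by
        rw [← abs_mul]
        congr 1
        push_cast
        field_simp
    _ ≤ 1 * 1 := by gcongr
    _ = 1 := one_mul 1

section Padic

variable {p : ℕ} [hp : Fact p.Prime]

lemma Padic.exists_nat_forall_norm_sub_le_iff {y : ℚ_[p]} (hy : ‖y‖ ≤ 1) (N : ℕ) :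
    ∃ a : ℕ, ∀ n : ℕ, ‖(n : ℚ_[p]) - y‖ ≤ (p : ℝ) ^ (-(N : ℤ)) ↔ n ≡ a [MOD p ^ N] := by
  let z : ℤ_[p] := ⟨y, hy⟩
  refine ⟨z.appr N, fun n ↦ ?_⟩
  have ha : ‖y - (z.appr N : ℚ_[p])‖ ≤ (p : ℝ) ^ (-(N : ℤ)) := by
    have := (PadicInt.norm_le_pow_iff_mem_span_pow _ N).2 (PadicInt.appr_spec N z)
    rw [PadicInt.norm_def, PadicInt.coe_sub, PadicInt.coe_natCast] at this
    exact this
  have hdvd : n ≡ z.appr N [MOD p ^ N] ↔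
      ‖(z.appr N : ℚ_[p]) - n‖ ≤ (p : ℝ) ^ (-(N : ℤ)) := by
    rw [Nat.modEq_iff_dvd, Nat.cast_pow, ← Padic.norm_int_le_pow_iff_dvd]
    push_cast
    rfl
  rw [hdvd]
  constructor
  · intro h
    have := (Padic.nonarchimedean ((n : ℚ_[p]) - y) (y - (z.appr N : ℚ_[p]))).trans (max_le h ha)
    rwa [sub_add_sub_cancel, norm_sub_rev] at this
  · intro h
    have := (Padic.nonarchimedean (y - (z.appr N : ℚ_[p])) ((z.appr N : ℚ_[p]) - n)).trans
      (max_le ha h)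
    rwa [sub_add_sub_cancel, norm_sub_rev] at this

lemma Padic.norm_eq_of_norm_sub_le {x y : ℚ_[p]} {v e : ℤ} (hx : ‖x‖ = (p : ℝ) ^ (-v))
    (he : v < e) (h : ‖y - x‖ ≤ (p : ℝ) ^ (-e)) : ‖y‖ = (p : ℝ) ^ (-v) := by
  rw [← hx]
  refine Padic.norm_eq_of_norm_sub_lt_right (h.trans_lt ?_)
  rw [hx]
  exact zpow_lt_zpow_right₀ (by exact_mod_cast hp.out.one_lt) (by lia)

lemma Padic.norm_div_sub_le_iff {u x w : ℚ_[p]} {v e : ℤ} (hu : ‖u‖ = 1) (hw : w ≠ 0)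
    (hx : ‖x‖ = (p : ℝ) ^ (-v)) (he : v < e) :
    ‖u / w - x‖ ≤ (p : ℝ) ^ (-e) ↔ ‖w - u / x‖ ≤ (p : ℝ) ^ (-(e - 2 * v)) := by
  have hp0 : (p : ℝ) ≠ 0 := by exact_mod_cast hp.out.ne_zero
  have hppos : (0 : ℝ) < p := by exact_mod_cast hp.out.pos
  have hx0 : x ≠ 0 := by
    rw [← norm_ne_zero_iff, hx]
    exact zpow_ne_zero _ hp0
  have hux : ‖u / x‖ = (p : ℝ) ^ (-(-v)) := by rw [norm_div, hu, hx, zpow_neg _ (-v), one_div]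
  have key : ‖w‖ = (p : ℝ) ^ v →
      (‖u / w - x‖ ≤ (p : ℝ) ^ (-e) ↔ ‖w - u / x‖ ≤ (p : ℝ) ^ (-(e - 2 * v))) := by
    intro hwn
    have h1 : u / w - x = -(x / w) * (w - u / x) := by field_simp; ring
    have h2 : (p : ℝ) ^ (-e) = (p : ℝ) ^ (-v - v) * (p : ℝ) ^ (-(e - 2 * v)) := by
      rw [← zpow_add₀ hp0]
      congr 1
      ring
    rw [h1, norm_mul, norm_neg, norm_div, hx, hwn, ← zpow_sub₀ hp0, h2,
      mul_le_mul_iff_right₀ (zpow_pos hppos _)]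
  refine ⟨fun h ↦ (key ?_).1 h, fun h ↦ (key ?_).2 h⟩
  · have := Padic.norm_eq_of_norm_sub_le hx he h
    rw [norm_div, hu, zpow_neg, one_div] at this
    exact inv_injective this
  · have := Padic.norm_eq_of_norm_sub_le (e := e - 2 * v) hux (by lia) h
    rwa [neg_neg] at this

/-- If a rational number has `p`-adic valuation at most zero, its numerator is a `p`-adic unit. -/
lemma Padic.norm_num_eq_one_and_norm_den_eq {r : ℚ} {v : ℤ} (hv : v ≤ 0)
    (hr : ‖(r : ℚ_[p])‖ = (p : ℝ) ^ (-v)) :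
    ‖(r.num : ℚ_[p])‖ = 1 ∧ ‖(r.den : ℚ_[p])‖ = (p : ℝ) ^ v := by
  have hp0 : (p : ℝ) ≠ 0 := by exact_mod_cast hp.out.ne_zero
  have hden : (r.den : ℚ_[p]) ≠ 0 := by exact_mod_cast r.den_nz
  have hmul : ‖(r.num : ℚ_[p])‖ = (p : ℝ) ^ (-v) * ‖(r.den : ℚ_[p])‖ := by
    rw [← hr, ← norm_mul]
    congr 1
    exact_mod_cast (Rat.mul_den_eq_num r).symm
  have hnum : ‖(r.num : ℚ_[p])‖ = 1 := by
    refine le_antisymm (Padic.norm_int_le_one _) (not_lt.1 fun hlt ↦ ?_)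
    have hdvd : p ∣ r.num.natAbs := Int.natCast_dvd.1 (Padic.norm_intCast_lt_one_iff.1 hlt)
    have hcop : p.Coprime r.den := r.reduced.coprime_dvd_left hdvd
    rw [hmul, Padic.norm_natCast_eq_one_iff.2 hcop, mul_one] at hlt
    exact absurd hlt (not_lt.2 (one_le_zpow₀ (by exact_mod_cast hp.out.one_le) (by lia)))
  refine ⟨hnum, ?_⟩
  rw [hnum, zpow_neg] at hmul
  field_simp at hmul
  exact hmul.symm

open Finset in
/-- The count of rationals with prescribed numerator `± t` close to `x`. -/
lemma abs_ncard_num_eq_sub_le {x : ℚ_[p]} {v e : ℤ} (hx : ‖x‖ = (p : ℝ) ^ (-v)) (hv : v ≤ 0)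
    (he : v < e) {t : ℕ} (ht : 0 < t) (hpt : p.Coprime t) {σ : ℤ} (hσ : σ.natAbs = 1) :
    |({r : ℚ | r.num = σ * t ∧ r.den ≤ t ∧ ‖(r : ℚ_[p]) - x‖ ≤ (p : ℝ) ^ (-e)}.ncard : ℝ)
      - (p : ℝ) ^ (2 * v - e) * t.totient| ≤ #t.divisors := by
  obtain ⟨N, hN⟩ := Int.eq_ofNat_of_zero_le (show 0 ≤ e - 2 * v by lia)
  have hp0 : (p : ℝ) ≠ 0 := by exact_mod_cast hp.out.ne_zero
  have hσt : ‖((σ * t : ℤ) : ℚ_[p])‖ = 1 := by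
    have h1 : ‖(t : ℚ_[p])‖ = 1 := Padic.norm_natCast_eq_one_iff.2 hpt
    rcases Int.natAbs_eq_iff.1 hσ with rfl | rfl <;> simpa using h1
  have hy : ‖((σ * t : ℤ) : ℚ_[p]) / x‖ ≤ 1 := by
    rw [norm_div, hσt, hx, zpow_neg, one_div, inv_inv]
    exact zpow_le_one_of_nonpos₀ (by exact_mod_cast hp.out.one_le) hv
  obtain ⟨a, ha⟩ := Padic.exists_nat_forall_norm_sub_le_iff hy N
  have hset : {r : ℚ | r.num = σ * t ∧ r.den ≤ t ∧ ‖(r : ℚ_[p]) - x‖ ≤ (p : ℝ) ^ (-e)} =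
      (fun n : ℕ ↦ ((σ * t : ℤ) : ℚ) / ((n : ℤ) : ℚ)) ''
        ({n ∈ Ioc 0 t | n.Coprime t ∧ n ≡ a [MOD p ^ N]} : Finset ℕ) := by
    have hcond : ∀ n : ℕ, 0 < n →
        (‖((((σ * t : ℤ) : ℚ) / ((n : ℤ) : ℚ) : ℚ) : ℚ_[p]) - x‖ ≤ (p : ℝ) ^ (-e) ↔
          n ≡ a [MOD p ^ N]) := by
      intro n hn
      have hn0 : (n : ℚ_[p]) ≠ 0 := by exact_mod_cast hn.ne'
      rw [← ha n, Rat.cast_div, Rat.cast_intCast, Rat.cast_intCast, Int.cast_natCast n,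
        Padic.norm_div_sub_le_iff hσt hn0 hx he, hN]
    ext r
    simp only [Set.mem_ofPred_eq, Set.mem_image, mem_coe, mem_filter, mem_Ioc]
    constructor
    · rintro ⟨hnum, hden, hclose⟩
      have hr : ((σ * t : ℤ) : ℚ) / ((r.den : ℤ) : ℚ) = r := by
        rw [← hnum]
        exact_mod_cast Rat.num_div_den r
      refine ⟨r.den, ⟨⟨r.pos, hden⟩, ?_, ?_⟩, hr⟩
      · have := r.reduced
        rw [hnum, Int.natAbs_mul, hσ, one_mul, Int.natAbs_natCast] at this
        exact this.symm
      · rwa [← hcond _ r.pos, hr]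
    · rintro ⟨n, ⟨⟨hn0, hnt⟩, hcop, hmod⟩, rfl⟩
      have hc : (σ * t : ℤ).natAbs.Coprime (n : ℤ).natAbs := by
        rw [Int.natAbs_mul, hσ, one_mul, Int.natAbs_natCast, Int.natAbs_natCast]
        exact hcop.symm
      refine ⟨Rat.num_div_eq_of_coprime (by lia) hc, ?_, (hcond n hn0).2 hmod⟩
      have := Rat.den_div_eq_of_coprime (a := σ * t) (b := n) (by lia) hc
      lia
  have hσ0 : σ ≠ 0 := by rintro rfl; simp at hσ
  have hinj : Function.Injective (fun n : ℕ ↦ ((σ * t : ℤ) : ℚ) / ((n : ℤ) : ℚ)) := by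
    intro m n hmn
    have h0 : ((σ * t : ℤ) : ℚ) ≠ 0 := by
      exact_mod_cast mul_ne_zero hσ0 (by exact_mod_cast ht.ne')
    have h1 := inv_injective (mul_left_cancel₀ h0 (by simpa only [div_eq_mul_inv] using hmn))
    exact_mod_cast h1
  rw [hset, Set.ncard_image_of_injective _ hinj, Set.ncard_coe_finset]
  have := abs_card_filter_coprime_modEq_sub_le ht (pow_pos hp.out.pos N)
    (Nat.Coprime.pow_right N hpt.symm) t a
  have hmain : (p : ℝ) ^ (2 * v - e) * t.totient =
      t / (p ^ N : ℕ) * ((t.totient : ℝ) / t) := by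
    have ht0 : (t : ℝ) ≠ 0 := by positivity
    rw [show 2 * v - e = -(N : ℤ) by lia, zpow_neg, zpow_natCast, Nat.cast_pow]
    field_simp
  rwa [hmain]

open Finset in
/-- The count of rationals with prescribed denominator `t` and prescribed sign close to `x`. -/
lemma abs_ncard_den_eq_sub_le {x : ℚ_[p]} {k : ℕ} {e : ℤ} (hx : ‖x‖ = (p : ℝ) ^ (-(-k : ℤ)))
    (he : -k < e) {s : ℕ} (hs : 0 < s) (hps : p.Coprime s) {σ : ℤ} (hσ : σ.natAbs = 1) :
    |({r : ℚ | r.den = p ^ k * s ∧ 0 < σ * r.num ∧ σ * r.num ≤ (p ^ k * s : ℕ) ∧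
        ‖(r : ℚ_[p]) - x‖ ≤ (p : ℝ) ^ (-e)}.ncard : ℝ)
      - (p : ℝ) ^ (-e) * s.totient| ≤ #s.divisors := by
  obtain ⟨N, hN⟩ := Int.eq_ofNat_of_zero_le (show 0 ≤ e + k by lia)
  have hp0 : (p : ℝ) ≠ 0 := by exact_mod_cast hp.out.ne_zero
  have hppos : (0 : ℝ) < p := by exact_mod_cast hp.out.pos
  have hσσ : σ * σ = 1 := by rcases Int.natAbs_eq_iff.1 hσ with rfl | rfl <;> rfl
  have hσσp : (σ : ℚ_[p]) * σ = 1 := by exact_mod_cast hσσ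
  have hσn : ‖(σ : ℚ_[p])‖ = 1 := by
    rcases Int.natAbs_eq_iff.1 hσ with rfl | rfl <;> simp
  have htpos : 0 < p ^ k * s := Nat.mul_pos (pow_pos hp.out.pos k) hs
  have htn : ‖((p ^ k * s : ℕ) : ℚ_[p])‖ = (p : ℝ) ^ (-k : ℤ) := by
    have h1 : ‖(s : ℚ_[p])‖ = 1 := Padic.norm_natCast_eq_one_iff.2 hps
    rw [Nat.cast_mul, norm_mul, h1, mul_one, Nat.cast_pow, Padic.norm_p_pow]
  generalize ht : p ^ k * s = t at *
  have ht0 : (t : ℚ_[p]) ≠ 0 := by exact_mod_cast htpos.ne'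
  have hy : ‖(σ : ℚ_[p]) * t * x‖ = 1 := by
    rw [norm_mul, norm_mul, hσn, htn, hx, one_mul, ← zpow_add₀ hp0, add_neg_cancel, zpow_zero]
  obtain ⟨a, ha⟩ := Padic.exists_nat_forall_norm_sub_le_iff hy.le N
  have hset : {r : ℚ | r.den = t ∧ 0 < σ * r.num ∧ σ * r.num ≤ t ∧
        ‖(r : ℚ_[p]) - x‖ ≤ (p : ℝ) ^ (-e)} =
      (fun n : ℕ ↦ ((σ * n : ℤ) : ℚ) / ((t : ℤ) : ℚ)) ''
        ({n ∈ Ioc 0 t | n.Coprime s ∧ n ≡ a [MOD p ^ N]} : Finset ℕ) := by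
    have hcond : ∀ n : ℕ,
        (‖((((σ * n : ℤ) : ℚ) / ((t : ℤ) : ℚ) : ℚ) : ℚ_[p]) - x‖ ≤ (p : ℝ) ^ (-e) ↔
          n ≡ a [MOD p ^ N]) := by
      intro n
      have h1 : ((((σ * n : ℤ) : ℚ) / ((t : ℤ) : ℚ) : ℚ) : ℚ_[p]) - x =
          σ / t * (n - σ * t * x) := by
        push_cast
        field_simp
        linear_combination (t : ℚ_[p]) * x * hσσp
      have h2 : (p : ℝ) ^ (-e) = 1 / (p : ℝ) ^ (-k : ℤ) * (p : ℝ) ^ (-(N : ℤ)) := by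
        rw [one_div, ← zpow_neg, ← zpow_add₀ hp0]
        congr 1
        lia
      rw [← ha n, h1, norm_mul, norm_div, hσn, htn, h2, mul_le_mul_iff_right₀ (by positivity)]
    ext r
    simp only [Set.mem_ofPred_eq, Set.mem_image, mem_coe, mem_filter, mem_Ioc]
    constructor
    · rintro ⟨hden, hpos, hle, hclose⟩
      obtain ⟨n, hn⟩ := Int.eq_ofNat_of_zero_le hpos.le
      have hnum : r.num = σ * n := by
        rw [show (n : ℤ) = σ * r.num from hn.symm, ← mul_assoc, hσσ, one_mul]
      have hr : ((σ * n : ℤ) : ℚ) / ((t : ℤ) : ℚ) = r := by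
        rw [← hnum, ← hden]
        exact_mod_cast Rat.num_div_den r
      refine ⟨n, ⟨⟨by lia, by lia⟩, ?_, ?_⟩, hr⟩
      · have := r.reduced
        rw [hnum, Int.natAbs_mul, hσ, one_mul, Int.natAbs_natCast, hden, ← ht] at this
        exact this.coprime_dvd_right (dvd_mul_left _ _)
      · rwa [← hcond, hr]
    · rintro ⟨n, ⟨⟨hn0, hnt⟩, hcop, hmod⟩, rfl⟩
      have hpn : p.Coprime n := by
        refine Padic.norm_natCast_eq_one_iff.1 ?_
        have := Padic.norm_eq_of_norm_sub_le (v := 0) (e := N) (by simpa using hy) (by lia)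
          ((ha n).2 hmod)
        simpa using this
      have hc : (σ * n : ℤ).natAbs.Coprime (t : ℤ).natAbs := by
        rw [Int.natAbs_mul, hσ, one_mul, Int.natAbs_natCast, Int.natAbs_natCast, ← ht]
        exact Nat.Coprime.mul_right (hpn.symm.pow_right k) hcop
      rw [Rat.num_div_eq_of_coprime (by lia) hc, ← mul_assoc, hσσ, one_mul]
      refine ⟨?_, by lia, by lia, (hcond n).2 hmod⟩
      exact_mod_cast Rat.den_div_eq_of_coprime (a := σ * n) (b := t) (by lia) hc
  have hσ0 : σ ≠ 0 := by rintro rfl; simp at hσ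
  have hinj : Function.Injective (fun n : ℕ ↦ ((σ * n : ℤ) : ℚ) / ((t : ℤ) : ℚ)) := by
    intro m n hmn
    have h0 : ((t : ℤ) : ℚ) ≠ 0 := by exact_mod_cast htpos.ne'
    have h1 : σ * m = σ * n := by exact_mod_cast (div_left_inj' h0).1 hmn
    exact_mod_cast mul_left_cancel₀ hσ0 h1
  rw [hset, Set.ncard_image_of_injective _ hinj, Set.ncard_coe_finset]
  have := abs_card_filter_coprime_modEq_sub_le hs (pow_pos hp.out.pos N)
    (Nat.Coprime.pow_right N hps.symm) t a
  have hmain : (p : ℝ) ^ (-e) * s.totient =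
      t / (p ^ N : ℕ) * ((s.totient : ℝ) / s) := by
    have hs0 : (s : ℝ) ≠ 0 := by positivity
    rw [show -e = (k : ℤ) - (N : ℤ) by lia, zpow_sub₀ hp0, zpow_natCast, zpow_natCast, ← ht]
    push_cast
    field_simp
  rwa [hmain]

end Padic

lemma finite_setOf_ratHeight_eq (t : ℕ) : {r : ℚ | ratHeight r = t}.Finite := by
  refine Set.Finite.of_finite_image (f := fun r : ℚ ↦ (r.num, r.den))
    (((Set.finite_Icc (-(t : ℤ)) t).prod (Set.finite_Iic t)).subset ?_) ?_
  · rintro _ ⟨r, hr, rfl⟩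
    simp only [Set.mem_ofPred_eq, ratHeight] at hr
    simp only [Set.mem_prod, Set.mem_Icc, Set.mem_Iic]
    lia
  · intro r _ r' _ h
    simp only [Prod.mk.injEq] at h
    exact Rat.ext h.1 h.2

/-- Proposition 6(2)–(3) of the paper: for a prime `p`, a nonzero `x ∈ ℚ_p`
and an integer `e > v_p(x)`, the count `N(t)` of rationals `r` of height
exactly `t` with `v_p(r - x) ≥ e` (equivalently `|r - x|_p ≤ p^{-e}`)
satisfies: if `v_p(x) < 0` then `|N(t) - 2 p^{2 v_p(x) - e} φ(t)| ≤ 4 d(t)`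
when `v_p(t) = 0`, `|N(t) - 2 (p^{1 + v_p(x) - e}/(p-1)) φ(t)| ≤ 4 d(t)` when
`v_p(t) = -v_p(x)`, and `N(t) = 0` otherwise; if instead `v_p(x) = 0` then
`|N(t) - 4 p^{-e} φ(t)| ≤ 8 d(t)` when `v_p(t) = 0`, and `N(t) = 0` when
`v_p(t) ≠ 0`. -/
theorem slice_count_val_neg_or_zero
    (p : ℕ) [hp : Fact p.Prime] (x : ℚ_[p]) (hx : x ≠ 0)
    (e : ℤ) (he : x.valuation < e) (t : ℕ) (ht : 0 < t) :
    (x.valuation < 0 →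
      (padicValNat p t = 0 →
        |(Nat.card {r : ℚ // ratHeight r = t ∧ ‖(r : ℚ_[p]) - x‖ ≤ (p : ℝ) ^ (-e)} : ℝ)
          - 2 * (p : ℝ) ^ (2 * x.valuation - e) * (t.totient : ℝ)|
          ≤ 4 * (t.divisors.card : ℝ)) ∧
      ((padicValNat p t : ℤ) = -x.valuation →
        |(Nat.card {r : ℚ // ratHeight r = t ∧ ‖(r : ℚ_[p]) - x‖ ≤ (p : ℝ) ^ (-e)} : ℝ)
          - 2 * ((p : ℝ) ^ (1 + x.valuation - e) / ((p : ℝ) - 1)) * (t.totient : ℝ)|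
          ≤ 4 * (t.divisors.card : ℝ)) ∧
      (padicValNat p t ≠ 0 → (padicValNat p t : ℤ) ≠ -x.valuation →
        Nat.card {r : ℚ // ratHeight r = t ∧ ‖(r : ℚ_[p]) - x‖ ≤ (p : ℝ) ^ (-e)} = 0)) ∧
    (x.valuation = 0 →
      (padicValNat p t = 0 →
        |(Nat.card {r : ℚ // ratHeight r = t ∧ ‖(r : ℚ_[p]) - x‖ ≤ (p : ℝ) ^ (-e)} : ℝ)
          - 4 * (p : ℝ) ^ (-e) * (t.totient : ℝ)| ≤ 8 * (t.divisors.card : ℝ)) ∧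
      (padicValNat p t ≠ 0 →
        Nat.card {r : ℚ // ratHeight r = t ∧ ‖(r : ℚ_[p]) - x‖ ≤ (p : ℝ) ^ (-e)} = 0)) := by
  have hxn := Padic.norm_eq_zpow_neg_valuation hx
  generalize x.valuation = v at *
  have hp1 : (1 : ℝ) < p := by exact_mod_cast hp.out.one_lt
  have hp0 : (p : ℝ) ≠ 0 := by positivity
  have hcast : Nat.card {r : ℚ // ratHeight r = t ∧ ‖(r : ℚ_[p]) - x‖ ≤ (p : ℝ) ^ (-e)} =
    {r : ℚ | ratHeight r = t ∧ ‖(r : ℚ_[p]) - x‖ ≤ (p : ℝ) ^ (-e)}.ncard := rfl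
  rw [hcast]
  have hdpos : (1 : ℝ) ≤ t.divisors.card := by
    exact_mod_cast Finset.card_pos.2 ⟨1, Nat.one_mem_divisors.2 ht.ne'⟩
  have hval : ∀ r : ℚ, ‖(r : ℚ_[p]) - x‖ ≤ (p : ℝ) ^ (-e) → v ≤ 0 →
      ‖(r.num : ℚ_[p])‖ = 1 ∧ ‖(r.den : ℚ_[p])‖ = (p : ℝ) ^ v := fun r hr hv ↦
    Padic.norm_num_eq_one_and_norm_den_eq hv (Padic.norm_eq_of_norm_sub_le hxn he hr)
  have htn : ‖(t : ℚ_[p])‖ = (p : ℝ) ^ (-(padicValNat p t) : ℤ) := by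
    rw [Padic.norm_eq_zpow_neg_valuation (by exact_mod_cast ht.ne'), Padic.valuation_natCast]
  have hzinj : ∀ a b : ℤ, (p : ℝ) ^ a = (p : ℝ) ^ b → a = b := fun a b h ↦
    zpow_right_injective₀ (by positivity) hp1.ne' h
  have hnumval : ∀ r : ℚ, ‖(r : ℚ_[p]) - x‖ ≤ (p : ℝ) ^ (-e) → v ≤ 0 →
      r.num.natAbs = t → padicValNat p t = 0 := by
    intro r hr hv h
    have h1 : ‖(t : ℚ_[p])‖ = 1 := by
      rw [← (hval r hr hv).1]
      rcases Int.natAbs_eq_iff.1 h with h | h <;> simp [h]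
    rw [htn, ← zpow_zero (p : ℝ)] at h1
    have := hzinj _ _ h1
    lia
  have hdenval : ∀ r : ℚ, ‖(r : ℚ_[p]) - x‖ ≤ (p : ℝ) ^ (-e) → v ≤ 0 →
      r.den = t → (padicValNat p t : ℤ) = -v := by
    intro r hr hv h
    have h1 := (hval r hr hv).2
    rw [h, htn] at h1
    have := hzinj _ _ h1
    lia
  have hnum0 : ∀ r : ℚ, ‖(r : ℚ_[p]) - x‖ ≤ (p : ℝ) ^ (-e) → v ≤ 0 → r.num ≠ 0 := by
    intro r hr hv h
    have := (hval r hr hv).1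
    simp [h] at this
  have hzero : v ≤ 0 → padicValNat p t ≠ 0 → (padicValNat p t : ℤ) ≠ -v →
      {r : ℚ | ratHeight r = t ∧ ‖(r : ℚ_[p]) - x‖ ≤ (p : ℝ) ^ (-e)}.ncard = 0 := by
    intro hv h0 h1
    have hempty : {r : ℚ | ratHeight r = t ∧ ‖(r : ℚ_[p]) - x‖ ≤ (p : ℝ) ^ (-e)} = ∅ := by
      refine Set.eq_empty_of_forall_notMem fun r ⟨hr, hclose⟩ ↦ ?_
      rcases max_choice r.num.natAbs r.den with h | h
      · exact h0 (hnumval r hclose hv (h.symm.trans hr))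
      · exact h1 (hdenval r hclose hv (h.symm.trans hr))
    rw [hempty, Set.ncard_empty]
  let A : ℤ → Set ℚ := fun σ ↦
    {r : ℚ | r.num = σ * t ∧ r.den ≤ t ∧ ‖(r : ℚ_[p]) - x‖ ≤ (p : ℝ) ^ (-e)}
  let B : ℤ → Set ℚ := fun σ ↦ {r : ℚ | r.den = t ∧ 0 < σ * r.num ∧ σ * r.num ≤ t ∧
    ‖(r : ℚ_[p]) - x‖ ≤ (p : ℝ) ^ (-e)}
  have hfin := finite_setOf_ratHeight_eq t
  have hAfin : ∀ σ : ℤ, σ.natAbs = 1 → (A σ).Finite := fun σ hσ ↦ hfin.subset fun r hr ↦ by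
    simp only [A, Set.mem_ofPred_eq, ratHeight] at hr ⊢
    rw [hr.1, Int.natAbs_mul, hσ]
    lia
  have hBfin : ∀ σ : ℤ, σ.natAbs = 1 → (B σ).Finite := fun σ hσ ↦ hfin.subset fun r hr ↦ by
    simp only [B, Set.mem_ofPred_eq, ratHeight] at hr ⊢
    rcases Int.natAbs_eq_iff.1 hσ with rfl | rfl <;> lia
  have hAunion : (A 1 ∪ A (-1)).ncard = (A 1).ncard + (A (-1)).ncard := by
    refine Set.ncard_union_eq (Set.disjoint_left.2 fun r h h' ↦ ?_) (hAfin _ rfl) (hAfin _ rfl)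
    simp only [A, Set.mem_ofPred_eq] at h h'
    lia
  have hBunion : (B 1 ∪ B (-1)).ncard = (B 1).ncard + (B (-1)).ncard := by
    refine Set.ncard_union_eq (Set.disjoint_left.2 fun r h h' ↦ ?_) (hBfin _ rfl) (hBfin _ rfl)
    simp only [B, Set.mem_ofPred_eq] at h h'
    lia
  have hAcount : v ≤ 0 → padicValNat p t = 0 →
      |((A 1 ∪ A (-1)).ncard : ℝ) - 2 * ((p : ℝ) ^ (2 * v - e) * t.totient)|
        ≤ 2 * t.divisors.card := by
    intro hv h0
    have hpt : p.Coprime t := by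
      rw [h0] at htn
      exact Padic.norm_natCast_eq_one_iff.1 (by simpa using htn)
    have h1 := abs_le.1 (abs_ncard_num_eq_sub_le hxn hv he ht hpt (σ := 1) rfl)
    have h2 := abs_le.1 (abs_ncard_num_eq_sub_le hxn hv he ht hpt (σ := -1) rfl)
    rw [hAunion, Nat.cast_add, abs_le]
    constructor <;> simp only [A] <;> linarith [h1.1, h1.2, h2.1, h2.2]
  have hBcount : ∀ s, t = p ^ padicValNat p t * s → p.Coprime s →
      (padicValNat p t : ℤ) = -v →
      |((B 1 ∪ B (-1)).ncard : ℝ) - 2 * ((p : ℝ) ^ (-e) * s.totient)|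
        ≤ 2 * t.divisors.card := by
    intro s hts hps hk
    have hs : 0 < s := Nat.pos_of_ne_zero (by rintro rfl; simp at hts; lia)
    have hds : (s.divisors.card : ℝ) ≤ t.divisors.card := by
      exact_mod_cast Finset.card_le_card
        (Nat.divisors_subset_of_dvd ht.ne' (hts ▸ dvd_mul_left _ _ : s ∣ t))
    have hxk : ‖x‖ = (p : ℝ) ^ (-(-(padicValNat p t) : ℤ)) := by rw [hxn, hk, neg_neg]
    have h1 := abs_le.1 (abs_ncard_den_eq_sub_le (e := e) hxk (by lia) hs hps (σ := 1) rfl)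
    have h2 := abs_le.1 (abs_ncard_den_eq_sub_le (e := e) hxk (by lia) hs hps (σ := -1) rfl)
    rw [← hts] at h1 h2
    rw [hBunion, Nat.cast_add, abs_le]
    constructor <;> simp only [B] <;> linarith [h1.1, h1.2, h2.1, h2.2]
  refine ⟨fun hv ↦ ⟨fun h0 ↦ ?_, fun hk ↦ ?_, hzero hv.le⟩, fun hv ↦ ⟨fun h0 ↦ ?_, fun h0 ↦
    hzero hv.le h0 (by lia)⟩⟩
  · have hS : {r : ℚ | ratHeight r = t ∧ ‖(r : ℚ_[p]) - x‖ ≤ (p : ℝ) ^ (-e)} =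
        A 1 ∪ A (-1) := by
      ext r
      simp only [A, Set.mem_ofPred_eq, ratHeight, Set.mem_union]
      constructor
      · rintro ⟨hr, hclose⟩
        have := hdenval r hclose hv.le
        have : r.num = t ∨ r.num = -t := by lia
        rcases this with h | h
        · exact Or.inl ⟨by lia, by lia, hclose⟩
        · exact Or.inr ⟨by lia, by lia, hclose⟩
      · rintro (⟨h, h', hclose⟩ | ⟨h, h', hclose⟩) <;> exact ⟨by lia, hclose⟩
    rw [hS, mul_assoc]
    exact (hAcount hv.le h0).trans (by linarith)
  · have hS : {r : ℚ | ratHeight r = t ∧ ‖(r : ℚ_[p]) - x‖ ≤ (p : ℝ) ^ (-e)} =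
        B 1 ∪ B (-1) := by
      ext r
      simp only [B, Set.mem_ofPred_eq, ratHeight, Set.mem_union]
      constructor
      · rintro ⟨hr, hclose⟩
        have h1 := hnumval r hclose hv.le
        have h2 := hnum0 r hclose hv.le
        rcases lt_or_gt_of_ne h2 with h | h
        · exact Or.inr ⟨by lia, by lia, by lia, hclose⟩
        · exact Or.inl ⟨by lia, by lia, by lia, hclose⟩
      · rintro (⟨h, h', h'', hclose⟩ | ⟨h, h', h'', hclose⟩) <;> exact ⟨by lia, hclose⟩
    obtain ⟨s, hts⟩ := pow_padicValNat_dvd (p := p) (n := t)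
    have hps : p.Coprime s := by
      refine (Nat.Prime.coprime_iff_not_dvd hp.out).2 fun ⟨c, hc⟩ ↦ ?_
      refine pow_succ_padicValNat_not_dvd (p := p) ht.ne' ⟨c, ?_⟩
      rw [pow_succ, mul_assoc, ← hc]
      exact hts
    have hkpos : 0 < padicValNat p t := by lia
    have hphi : (t.totient : ℝ) = (p : ℝ) ^ (-v - 1) * (p - 1) * s.totient := by
      conv_lhs => rw [hts]
      rw [Nat.totient_mul (hps.pow_left _), Nat.totient_prime_pow hp.out hkpos,
        show -v - 1 = ((padicValNat p t - 1 : ℕ) : ℤ) by lia, zpow_natCast]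
      push_cast [hp.out.one_le]
      ring
    have hmain : 2 * ((p : ℝ) ^ (1 + v - e) / ((p : ℝ) - 1)) * (t.totient : ℝ) =
        2 * ((p : ℝ) ^ (-e) * s.totient) := by
      have hp1' : (p : ℝ) - 1 ≠ 0 := by linarith
      rw [hphi, show -e = (1 + v - e) + (-v - 1) by ring, zpow_add₀ hp0 (1 + v - e)]
      field_simp
    rw [hS, hmain]
    exact (hBcount s hts hps hk).trans (by linarith)
  · have hS : {r : ℚ | ratHeight r = t ∧ ‖(r : ℚ_[p]) - x‖ ≤ (p : ℝ) ^ (-e)} =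
        (A 1 ∪ A (-1)) ∪ (B 1 ∪ B (-1)) := by
      ext r
      simp only [A, B, Set.mem_ofPred_eq, ratHeight, Set.mem_union]
      constructor
      · rintro ⟨hr, hclose⟩
        have h2 := hnum0 r hclose hv.le
        have : r.num = t ∨ r.num = -t ∨ r.den = t := by lia
        rcases this with h | h | h
        · exact Or.inl (Or.inl ⟨by lia, by lia, hclose⟩)
        · exact Or.inl (Or.inr ⟨by lia, by lia, hclose⟩)
        · rcases lt_or_gt_of_ne h2 with h' | h'
          · exact Or.inr (Or.inr ⟨by lia, by lia, by lia, hclose⟩)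
          · exact Or.inr (Or.inl ⟨by lia, by lia, by lia, hclose⟩)
      · rintro ((⟨h, h', hclose⟩ | ⟨h, h', hclose⟩) |
          (⟨h, h', h'', hclose⟩ | ⟨h, h', h'', hclose⟩)) <;> exact ⟨by lia, hclose⟩
    have hinter : ((A 1 ∪ A (-1)) ∩ (B 1 ∪ B (-1))).ncard ≤ 2 := by
      refine (Set.ncard_le_ncard (t := {(1 : ℚ), -1}) ?_).trans
        ((Set.ncard_insert_le _ _).trans (by simp))
      rintro r ⟨hA, hB⟩
      have hnum : r.num.natAbs = t := by
        simp only [A, Set.mem_ofPred_eq, Set.mem_union] at hA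
        lia
      have hden : r.den = t := by
        simp only [B, Set.mem_ofPred_eq, Set.mem_union] at hB
        lia
      have hred := r.reduced
      rw [hnum, hden, Nat.coprime_self] at hred
      rcases Int.natAbs_eq_iff.1 (hnum.trans hred) with h | h
      · exact Or.inl (Rat.ext h (hden.trans hred))
      · exact Or.inr (Rat.ext h (hden.trans hred))
    have hadd := Set.ncard_union_add_ncard_inter (A 1 ∪ A (-1)) (B 1 ∪ B (-1))
      ((hAfin _ rfl).union (hAfin _ rfl)) ((hBfin _ rfl).union (hBfin _ rfl))
    have hps : p.Coprime t := by
      rw [h0] at htn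
      exact Padic.norm_natCast_eq_one_iff.1 (by simpa using htn)
    have h1 := abs_le.1 (hAcount hv.le h0)
    have h2 := abs_le.1 (hBcount t (by rw [h0, pow_zero, one_mul]) hps (by lia))
    have hinter' : (((A 1 ∪ A (-1)) ∩ (B 1 ∪ B (-1))).ncard : ℝ) ≤ 2 := by exact_mod_cast hinter
    have hinter0 : (0 : ℝ) ≤ ((A 1 ∪ A (-1)) ∩ (B 1 ∪ B (-1))).ncard := Nat.cast_nonneg _
    have hadd' : ((((A 1 ∪ A (-1)) ∪ (B 1 ∪ B (-1))).ncard : ℝ) +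
        ((A 1 ∪ A (-1)) ∩ (B 1 ∪ B (-1))).ncard) =
        (A 1 ∪ A (-1)).ncard + (B 1 ∪ B (-1)).ncard := by exact_mod_cast hadd
    rw [hv, mul_zero, zero_sub] at h1
    rw [hS, abs_le]
    constructor <;> linarith [h1.1, h1.2, h2.1, h2.2]
end
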